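/- Let X = X₁ × ⋯ × X_n be a product of n topological spaces, and let (F_i)_{i ∈ I} be a locally finite family of closed subsets of X such that each F_i is projectively nowhere dense with respect to the k-th variable (for a fixed k ∈ {1, …, n}). Then the union ⋃_{i ∈ I} F_i is closed and locally projectively nowhere dense with respect to the k-th variable. -/

import Mathlib

/-- A function on a product of `n` topological spaces is separately continuous
if it is continuous in each variable when the other variables are fixed. -/
def SeparatelyContinuous {n : ℕ} {X : Fin n → Type*} [∀ i, TopologicalSpace (X i)]
    (f : (∀ i, X i) → ℝ) : Prop :=
  ∀ (k : Fin n) (x : ∀ i, X i), Continuous fun t : X k => f (Function.update x k t)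

/-- The projection of the product `X₁ × ⋯ × Xₙ` omitting the `k`-th coordinate. -/
def projHat {n : ℕ} {X : Fin n → Type*} (k : Fin n) (x : ∀ i, X i) :
    ∀ i : {i : Fin n // i ≠ k}, X i.1 :=
  fun i => x i.1

/-- A set `A` in a product is projectively meager with respect to the `k`-th
variable if its projection omitting the `k`-th coordinate is meager. -/
def ProjectivelyMeagerWrt {n : ℕ} {X : Fin n → Type*} [∀ i, TopologicalSpace (X i)]
    (k : Fin n) (A : Set (∀ i, X i)) : Prop :=
  IsMeagre (projHat k '' A)

/-- `A` is locally projectively meager with respect to the `k`-th variable if every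
point has a neighborhood `U` such that `A ∩ U` is projectively meager w.r.t. `k`. -/
def LocallyProjectivelyMeagerWrt {n : ℕ} {X : Fin n → Type*} [∀ i, TopologicalSpace (X i)]
    (k : Fin n) (A : Set (∀ i, X i)) : Prop :=
  ∀ x : ∀ i, X i, ∃ U ∈ nhds x, ProjectivelyMeagerWrt k (A ∩ U)

/-- `A` is locally projectively meager if it is locally projectively meager with
respect to every variable. -/
def LocallyProjectivelyMeager {n : ℕ} {X : Fin n → Type*} [∀ i, TopologicalSpace (X i)]
    (A : Set (∀ i, X i)) : Prop :=
  ∀ k : Fin n, LocallyProjectivelyMeagerWrt k A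

/-- A set `A` in a product is projectively nowhere dense with respect to the `k`-th
variable if its projection omitting the `k`-th coordinate is nowhere dense. -/
def ProjectivelyNowhereDenseWrt {n : ℕ} {X : Fin n → Type*} [∀ i, TopologicalSpace (X i)]
    (k : Fin n) (A : Set (∀ i, X i)) : Prop :=
  IsNowhereDense (projHat k '' A)

/-- `A` is locally projectively nowhere dense with respect to the `k`-th variable if
every point has a neighborhood `U` such that `A ∩ U` is projectively nowhere dense
w.r.t. `k`. -/
def LocallyProjectivelyNowhereDenseWrt {n : ℕ} {X : Fin n → Type*}
    [∀ i, TopologicalSpace (X i)] (k : Fin n) (A : Set (∀ i, X i)) : Prop :=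
  ∀ x : ∀ i, X i, ∃ U ∈ nhds x, ProjectivelyNowhereDenseWrt k (A ∩ U)

/-- `A` is locally projectively nowhere dense if it is locally projectively nowhere
dense with respect to every variable. -/
def LocallyProjectivelyNowhereDense {n : ℕ} {X : Fin n → Type*}
    [∀ i, TopologicalSpace (X i)] (A : Set (∀ i, X i)) : Prop :=
  ∀ k : Fin n, LocallyProjectivelyNowhereDenseWrt k A

/-- An `F_σ` set is a countable union of closed sets. -/
def IsFsigma {X : Type*} [TopologicalSpace X] (s : Set X) : Prop :=
  ∃ F : ℕ → Set X, (∀ n, IsClosed (F n)) ∧ s = ⋃ n, F n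

theorem IsNowhereDense.union {Y : Type*} [TopologicalSpace Y] {s t : Set Y}
    (hs : IsNowhereDense s) (ht : IsNowhereDense t) : IsNowhereDense (s ∪ t) := by
  unfold IsNowhereDense at *
  rw [closure_union, interior_union_isClosed_of_interior_empty isClosed_closure ht, hs]

theorem Set.Finite.isNowhereDense_biUnion {Y ι : Type*} [TopologicalSpace Y] {I : Set ι}
    (hI : I.Finite) {f : ι → Set Y} (hf : ∀ i ∈ I, IsNowhereDense (f i)) :
    IsNowhereDense (⋃ i ∈ I, f i) := by
  induction I, hI using Set.Finite.induction_on with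
  | empty => simp [isNowhereDense_empty]
  | insert _ _ ih =>
    rw [Set.biUnion_insert]
    exact (hf _ (Set.mem_insert _ _)).union (ih fun i hi => hf i (Set.mem_insert_of_mem _ hi))

theorem locallyFinite_union_closed_projNwd
    {n : ℕ} {X : Fin n → Type*} [∀ i, TopologicalSpace (X i)]
    {ι : Type*} (F : ι → Set (∀ i, X i))
    (hlf : LocallyFinite F) (hcl : ∀ i, IsClosed (F i)) (k : Fin n)
    (hnwd : ∀ i, ProjectivelyNowhereDenseWrt k (F i)) :
    IsClosed (⋃ i, F i) ∧ LocallyProjectivelyNowhereDenseWrt k (⋃ i, F i) := by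
  refine ⟨hlf.isClosed_iUnion hcl, fun x => ?_⟩
  obtain ⟨U, hU, hfin⟩ := hlf x
  refine ⟨U, hU, (hfin.isNowhereDense_biUnion fun i _ => hnwd i).mono ?_⟩
  rintro _ ⟨y, ⟨hy, hyU⟩, rfl⟩
  obtain ⟨i, hi⟩ := Set.mem_iUnion.1 hy
  exact Set.mem_biUnion (show i ∈ {i | (F i ∩ U).Nonempty} from ⟨y, hi, hyU⟩)
    (Set.mem_image_of_mem _ hi)
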